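/- Let τ0 < τ0' in (a,b) and x0, x0' ∈ J with L := |x0' − x0| > 0. If D ∈ ℝ satisfies G(τ) > D for every τ ∈ [τ0, τ0'] and ∫_{τ0}^{τ0'} f(τ)^{−2} (G(τ) − D)^{−1/2} dτ = L, then there exist t1 > 0 and a geodesic γ : [0, t1] → M of g^f with γ(0) = (τ0, x0), γ(t1) = (τ0', x0') and energy D. -/

import Mathlib

open Set Filter MeasureTheory Topology
open scoped ENNReal NNReal

noncomputable section

namespace GRW

/-- The open interval `(a,b)` (extended-real endpoints) as a subset of `ℝ`. -/
def II (aE bE : EReal) : Set ℝ := {τ : ℝ | aE < (τ : EReal) ∧ (τ : EReal) < bE}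

/-- `G = 1/f²`. -/
def G (f : ℝ → ℝ) (τ : ℝ) : ℝ := ((f τ) ^ 2)⁻¹

/-- The nonnegative integrand `f⁻² (G − D)^{-1/2}`, valued in `[0,∞]`. -/
def h (f : ℝ → ℝ) (D τ : ℝ) : ℝ≥0∞ :=
  ENNReal.ofReal ((f τ ^ 2 * Real.sqrt (G f τ - D))⁻¹)

/-- A geodesic `t ↦ (σ t, x t)` of `g^f = -dτ² + f(τ)² dx²` defined on `[t0, t1]`,
with values in the spacetime `(a,b) × J`. -/
structure IsGeodesicOn (aE bE : EReal) (f : ℝ → ℝ) (J : Set ℝ)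
    (σ x : ℝ → ℝ) (t0 t1 : ℝ) : Prop where
  mem_base : ∀ t ∈ Icc t0 t1, σ t ∈ II aE bE
  mem_fiber : ∀ t ∈ Icc t0 t1, x t ∈ J
  smooth_base : ContDiffOn ℝ 2 σ (Icc t0 t1)
  smooth_fiber : ContDiffOn ℝ 2 x (Icc t0 t1)
  eq_base : ∀ t ∈ Icc t0 t1,
    derivWithin (derivWithin σ (Icc t0 t1)) (Icc t0 t1) t
      = -(f (σ t) * deriv f (σ t) * (derivWithin x (Icc t0 t1) t) ^ 2)
  eq_fiber : ∀ t ∈ Icc t0 t1,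
    derivWithin (derivWithin x (Icc t0 t1)) (Icc t0 t1) t
      = -(2 * (deriv f (σ t) / f (σ t)) * derivWithin σ (Icc t0 t1) t
          * derivWithin x (Icc t0 t1) t)

/-- The energy `-(τ')² + f(τ)² (x')²` of a curve `(σ, x)` parameterized on `[t0,t1]`. -/
def energyW (f σ x : ℝ → ℝ) (t0 t1 t : ℝ) : ℝ :=
  -(derivWithin σ (Icc t0 t1) t) ^ 2 + (f (σ t)) ^ 2 * (derivWithin x (Icc t0 t1) t) ^ 2

/-- The velocity of a curve `(σ, x)` parameterized on `[t0,t1]`. -/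
def velW (σ x : ℝ → ℝ) (t0 t1 t : ℝ) : ℝ × ℝ :=
  (derivWithin σ (Icc t0 t1) t, derivWithin x (Icc t0 t1) t)

/-- Geodesic connectedness of the GRW spacetime `(a,b) × J`. -/
def GeodConnected (aE bE : EReal) (f : ℝ → ℝ) (J : Set ℝ) : Prop :=
  ∀ τ0 x0 τ0' x0' : ℝ, τ0 ∈ II aE bE → x0 ∈ J → τ0' ∈ II aE bE → x0' ∈ J →
    ∃ (σ x : ℝ → ℝ) (t1 : ℝ), 0 ≤ t1 ∧ IsGeodesicOn aE bE f J σ x 0 t1 ∧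
      σ 0 = τ0 ∧ x 0 = x0 ∧ σ t1 = τ0' ∧ x t1 = x0'

/-- Two points are related by a piecewise-`C¹` curve in the spacetime all of whose pieces
satisfy the pointwise condition `P` on (energy density, velocity). -/
def RelatedVia (aE bE : EReal) (f : ℝ → ℝ) (J : Set ℝ)
    (P : ℝ → ℝ × ℝ → Prop) (z z' : ℝ × ℝ) : Prop :=
  ∃ (n : ℕ) (s : ℕ → ℝ) (σ x : ℝ → ℝ),
    s 0 = 0 ∧ s (n + 1) = 1 ∧ (∀ i ≤ n, s i < s (i + 1)) ∧
    σ 0 = z.1 ∧ x 0 = z.2 ∧ σ 1 = z'.1 ∧ x 1 = z'.2 ∧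
    (∀ t ∈ Icc (0:ℝ) 1, σ t ∈ II aE bE ∧ x t ∈ J) ∧
    ContinuousOn σ (Icc 0 1) ∧ ContinuousOn x (Icc 0 1) ∧
    ∀ i ≤ n, ContDiffOn ℝ 1 σ (Icc (s i) (s (i + 1))) ∧
      ContDiffOn ℝ 1 x (Icc (s i) (s (i + 1))) ∧
      ∀ t ∈ Icc (s i) (s (i + 1)),
        P (energyW f σ x (s i) (s (i + 1)) t) (velW σ x (s i) (s (i + 1)) t)

/-- Timelike related: joined by a piecewise smooth timelike curve. -/
def TimelikeRel (aE bE : EReal) (f : ℝ → ℝ) (J : Set ℝ) (z z' : ℝ × ℝ) : Prop :=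
  RelatedVia aE bE f J (fun q _ => q < 0) z z'

/-- Spacelike related: joined by a piecewise smooth spacelike curve. -/
def SpacelikeRel (aE bE : EReal) (f : ℝ → ℝ) (J : Set ℝ) (z z' : ℝ × ℝ) : Prop :=
  RelatedVia aE bE f J (fun q _ => 0 < q) z z'

/-- Lightlike related: joined by a piecewise smooth lightlike curve with
nowhere-vanishing velocity. -/
def LightlikeRel (aE bE : EReal) (f : ℝ → ℝ) (J : Set ℝ) (z z' : ℝ × ℝ) : Prop :=
  RelatedVia aE bE f J (fun q v => q = 0 ∧ v ≠ 0) z z'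

/-- The filter of approach to `b` from inside `(a,b)`. -/
def Fb (bE : EReal) : Filter ℝ := comap (fun τ : ℝ => (τ : EReal)) (𝓝[<] bE)

/-- The filter of approach to `a` from inside `(a,b)`. -/
def Fa (aE : EReal) : Filter ℝ := comap (fun τ : ℝ => (τ : EReal)) (𝓝[>] aE)

/-- `m_b = liminf_{τ→b} G(τ)`, valued in `EReal`. -/
def mB (bE : EReal) (f : ℝ → ℝ) : EReal := liminf (fun τ => (G f τ : EReal)) (Fb bE)

/-- `m_a = liminf_{τ→a} G(τ)`, valued in `EReal`. -/
def mA (aE : EReal) (f : ℝ → ℝ) : EReal := liminf (fun τ => (G f τ : EReal)) (Fa aE)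

/-- `c` witnesses that `G` reaches a relative minimum at `b`: `G > m_b` on `(c,b)`. -/
def RelMinB (aE bE : EReal) (f : ℝ → ℝ) (c : ℝ) : Prop :=
  c ∈ II aE bE ∧ ∀ τ : ℝ, c < τ → (τ : EReal) < bE → mB bE f < (G f τ : EReal)

/-- `c` witnesses that `G` reaches a relative minimum at `a`: `G > m_a` on `(a,c)`. -/
def RelMinA (aE bE : EReal) (f : ℝ → ℝ) (c : ℝ) : Prop :=
  c ∈ II aE bE ∧ ∀ τ : ℝ, τ < c → aE < (τ : EReal) → mA aE f < (G f τ : EReal)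

/-- `∫_c^b f⁻²(G−D)^{-1/2}`, valued in `[0,∞]`. -/
def IbInt (bE : EReal) (f : ℝ → ℝ) (c D : ℝ) : ℝ≥0∞ :=
  ∫⁻ τ in {τ : ℝ | c < τ ∧ (τ : EReal) < bE}, h f D τ

/-- `∫_a^c f⁻²(G−D)^{-1/2}`, valued in `[0,∞]`. -/
def IaInt (aE : EReal) (f : ℝ → ℝ) (c D : ℝ) : ℝ≥0∞ :=
  ∫⁻ τ in {τ : ℝ | aE < (τ : EReal) ∧ τ < c}, h f D τ

/-- Condition (A) at `b`. -/
def CondA_b (aE bE : EReal) (f : ℝ → ℝ) : Prop :=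
  (¬ ∃ c, RelMinB aE bE f c) ∨
  ∃ c, RelMinB aE bE f c ∧ IbInt bE f c (mB bE f).toReal = ⊤

/-- Condition (A) at `a`. -/
def CondA_a (aE bE : EReal) (f : ℝ → ℝ) : Prop :=
  (¬ ∃ c, RelMinA aE bE f c) ∨
  ∃ c, RelMinA aE bE f c ∧ IaInt aE f c (mA aE f).toReal = ⊤

/-- Condition (A). -/
def CondA (aE bE : EReal) (f : ℝ → ℝ) : Prop :=
  CondA_a aE bE f ∧ CondA_b aE bE f

/-- `b^*(D) = inf {τ ∈ (c,b) | G τ = D}`, defaulting to `b` when the set is empty. -/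
def bstar (bE : EReal) (f : ℝ → ℝ) (c D : ℝ) : EReal :=
  sInf (insert bE ((fun τ : ℝ => (τ : EReal)) ''
    {τ : ℝ | c < τ ∧ (τ : EReal) < bE ∧ G f τ = D}))

/-- `a^*(D) = sup {τ ∈ (a,c) | G τ = D}`, defaulting to `a` when the set is empty. -/
def astar (aE : EReal) (f : ℝ → ℝ) (c D : ℝ) : EReal :=
  sSup (insert aE ((fun τ : ℝ => (τ : EReal)) ''
    {τ : ℝ | τ < c ∧ aE < (τ : EReal) ∧ G f τ = D}))

/-- `∫_c^{b^*(D)} f⁻²(G−D)^{-1/2}`. -/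
def IbStar (bE : EReal) (f : ℝ → ℝ) (c D : ℝ) : ℝ≥0∞ :=
  ∫⁻ τ in {τ : ℝ | c < τ ∧ (τ : EReal) < bstar bE f c D}, h f D τ

/-- `∫_{a^*(D)}^c f⁻²(G−D)^{-1/2}`. -/
def IaStar (aE : EReal) (f : ℝ → ℝ) (c D : ℝ) : ℝ≥0∞ :=
  ∫⁻ τ in {τ : ℝ | astar aE f c D < (τ : EReal) ∧ τ < c}, h f D τ

/-- `d_b`, computed with respect to the cut point `c`. -/
def dB (bE : EReal) (f : ℝ → ℝ) (c : ℝ) : ℝ≥0∞ :=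
  limsup (fun D => IbStar bE f c D) (𝓝[>] (mB bE f).toReal) - IbInt bE f c (mB bE f).toReal

/-- `d_a`, computed with respect to the cut point `c`. -/
def dA (aE : EReal) (f : ℝ → ℝ) (c : ℝ) : ℝ≥0∞ :=
  limsup (fun D => IaStar aE f c D) (𝓝[>] (mA aE f).toReal) - IaInt aE f c (mA aE f).toReal

/-- Condition (B) at `b`. -/
def CondB_b (aE bE : EReal) (f : ℝ → ℝ) (J : Set ℝ) : Prop :=
  CondA_b aE bE f ∨ ∃ c, RelMinB aE bE f c ∧ EMetric.diam J ≤ 2 * dB bE f c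

/-- Condition (B) at `a`. -/
def CondB_a (aE bE : EReal) (f : ℝ → ℝ) (J : Set ℝ) : Prop :=
  CondA_a aE bE f ∨ ∃ c, RelMinA aE bE f c ∧ EMetric.diam J ≤ 2 * dA aE f c

/-- Condition (B). -/
def CondB (aE bE : EReal) (f : ℝ → ℝ) (J : Set ℝ) : Prop :=
  CondB_a aE bE f J ∧ CondB_b aE bE f J

/-- `m = inf_{(a,b)} G`. -/
def mGlob (aE bE : EReal) (f : ℝ → ℝ) : ℝ := sInf (G f '' II aE bE)

/-- `α(D) = sup {τ ∈ (a,b) | G τ = D}`. -/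
def alphaD (aE bE : EReal) (f : ℝ → ℝ) (D : ℝ) : EReal :=
  sSup ((fun τ : ℝ => (τ : EReal)) '' {τ : ℝ | τ ∈ II aE bE ∧ G f τ = D})

/-- `β(D) = inf {τ ∈ (a,b) | G τ = D}`. -/
def betaD (aE bE : EReal) (f : ℝ → ℝ) (D : ℝ) : EReal :=
  sInf ((fun τ : ℝ => (τ : EReal)) '' {τ : ℝ | τ ∈ II aE bE ∧ G f τ = D})

/-- `i_b = inf_{D ∈ (m, m_b)} ∫_{α(D)}^b f⁻²(G−D)^{-1/2}`. -/
def iB (aE bE : EReal) (f : ℝ → ℝ) : ℝ≥0∞ :=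
  ⨅ D ∈ Ioo (mGlob aE bE f) (mB bE f).toReal,
    ∫⁻ τ in {τ : ℝ | alphaD aE bE f D < (τ : EReal) ∧ (τ : EReal) < bE}, h f D τ

/-- `i_a = inf_{D ∈ (m, m_a)} ∫_a^{β(D)} f⁻²(G−D)^{-1/2}`. -/
def iA (aE bE : EReal) (f : ℝ → ℝ) : ℝ≥0∞ :=
  ⨅ D ∈ Ioo (mGlob aE bE f) (mA aE f).toReal,
    ∫⁻ τ in {τ : ℝ | aE < (τ : EReal) ∧ (τ : EReal) < betaD aE bE f D}, h f D τ

/-- Condition (C) at `b`. -/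
def CondC_b (aE bE : EReal) (f : ℝ → ℝ) (J : Set ℝ) : Prop :=
  CondB_b aE bE f J ∨
    ((mGlob aE bE f : EReal) < mB bE f ∧ ∃ c, RelMinB aE bE f c ∧ iB aE bE f ≤ dB bE f c)

/-- Condition (C) at `a`. -/
def CondC_a (aE bE : EReal) (f : ℝ → ℝ) (J : Set ℝ) : Prop :=
  CondB_a aE bE f J ∨
    ((mGlob aE bE f : EReal) < mA aE f ∧ ∃ c, RelMinA aE bE f c ∧ iA aE bE f ≤ dA aE f c)

/-- Condition (C). -/
def CondC (aE bE : EReal) (f : ℝ → ℝ) (J : Set ℝ) : Prop :=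
  CondC_a aE bE f J ∧ CondC_b aE bE f J

/-! ### Condition (R) -/

/-- `b^*(D) = inf {τ ∈ [τ0, b) | G τ = D}` (defaulting to `b`). -/
def bstarR (bE : EReal) (f : ℝ → ℝ) (τ0 D : ℝ) : EReal :=
  sInf (insert bE ((fun τ : ℝ => (τ : EReal)) ''
    {τ : ℝ | τ0 ≤ τ ∧ (τ : EReal) < bE ∧ G f τ = D}))

/-- `a^*(D) = sup {τ ∈ (a, τ0] | G τ = D}` (defaulting to `a`). -/
def astarR (aE : EReal) (f : ℝ → ℝ) (τ0 D : ℝ) : EReal :=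
  sSup (insert aE ((fun τ : ℝ => (τ : EReal)) ''
    {τ : ℝ | τ ≤ τ0 ∧ aE < (τ : EReal) ∧ G f τ = D}))

/-- `A(D) = ∫_{a^*(D)}^{τ0} h_D`. -/
def AInt (aE : EReal) (f : ℝ → ℝ) (τ0 D : ℝ) : ℝ≥0∞ :=
  ∫⁻ τ in {τ : ℝ | astarR aE f τ0 D < (τ : EReal) ∧ τ < τ0}, h f D τ

/-- `B(D) = ∫_{τ0}^{b^*(D)} h_D`. -/
def BInt (bE : EReal) (f : ℝ → ℝ) (τ0 D : ℝ) : ℝ≥0∞ :=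
  ∫⁻ τ in {τ : ℝ | τ0 < τ ∧ (τ : EReal) < bstarR bE f τ0 D}, h f D τ

/-- `T(D) = ∫_{a^*(D)}^{b^*(D)} h_D`. -/
def TInt (aE bE : EReal) (f : ℝ → ℝ) (τ0 D : ℝ) : ℝ≥0∞ :=
  ∫⁻ τ in {τ : ℝ | astarR aE f τ0 D < (τ : EReal) ∧ (τ : EReal) < bstarR bE f τ0 D},
    h f D τ

/-- The point `b − ε` (replaced by `1/ε` when `b = ∞`). -/
def bEnd (bE : EReal) (ε : ℝ) : ℝ := if bE = ⊤ then ε⁻¹ else bE.toReal - ε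

/-- The point `a + ε` (replaced by `−1/ε` when `a = −∞`). -/
def aEnd (aE : EReal) (ε : ℝ) : ℝ := if aE = ⊥ then -ε⁻¹ else aE.toReal + ε

/-- The oriented integral `Q(D,ε) = ∫_{b−ε}^{b^*(D)} h_D`, valued in `[−∞,∞]`. -/
def QInt (bE : EReal) (f : ℝ → ℝ) (τ0 D ε : ℝ) : EReal :=
  if ((bEnd bE ε : ℝ) : EReal) ≤ bstarR bE f τ0 D then
    ((∫⁻ τ in {τ : ℝ | bEnd bE ε < τ ∧ (τ : EReal) < bstarR bE f τ0 D}, h f D τ : ℝ≥0∞) :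
      EReal)
  else
    -((∫⁻ τ in {τ : ℝ | bstarR bE f τ0 D < (τ : EReal) ∧ τ < bEnd bE ε}, h f D τ : ℝ≥0∞) :
      EReal)

/-- The oriented integral `Q'(D,ε) = ∫_{a^*(D)}^{a+ε} h_D`, valued in `[−∞,∞]`. -/
def QInt' (aE : EReal) (f : ℝ → ℝ) (τ0 D ε : ℝ) : EReal :=
  if astarR aE f τ0 D ≤ ((aEnd aE ε : ℝ) : EReal) then
    ((∫⁻ τ in {τ : ℝ | astarR aE f τ0 D < (τ : EReal) ∧ τ < aEnd aE ε}, h f D τ : ℝ≥0∞) :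
      EReal)
  else
    -((∫⁻ τ in {τ : ℝ | aEnd aE ε < τ ∧ (τ : EReal) < astarR aE f τ0 D}, h f D τ : ℝ≥0∞) :
      EReal)

/-- `C_n(D)`: `B(D)` for even `n`, `A(D)` for odd `n`. -/
def CInt (aE bE : EReal) (f : ℝ → ℝ) (τ0 : ℝ) (n : ℕ) (D : ℝ) : ℝ≥0∞ :=
  if Even n then BInt bE f τ0 D else AInt aE f τ0 D

/-- `C'_n(D)`: `A(D)` for even `n`, `B(D)` for odd `n`. -/
def CInt' (aE bE : EReal) (f : ℝ → ℝ) (τ0 : ℝ) (n : ℕ) (D : ℝ) : ℝ≥0∞ :=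
  if Even n then AInt aE f τ0 D else BInt bE f τ0 D

/-- `r_i^n(τ0) = lim_{ε↘0} liminf_{D↘m} (C_n(D) + n·T(D) − Q(D,ε))`; since the inner
quantity is nonincreasing in `ε`, the limit as `ε ↘ 0` is the supremum over `ε > 0`. -/
def rI (aE bE : EReal) (f : ℝ → ℝ) (τ0 : ℝ) (n : ℕ) : EReal :=
  ⨆ ε : {e : ℝ // 0 < e},
    liminf (fun D =>
        ((CInt aE bE f τ0 n D + n * TInt aE bE f τ0 D : ℝ≥0∞) : EReal)
          - QInt bE f τ0 D ε.1)
      (𝓝[>] (mGlob aE bE f))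

/-- `r_s^n(τ0) = lim_{ε↘0} limsup_{D↘m} (C_n(D) + n·T(D) + Q(D,ε))`. -/
def rS (aE bE : EReal) (f : ℝ → ℝ) (τ0 : ℝ) (n : ℕ) : EReal :=
  ⨅ ε : {e : ℝ // 0 < e},
    limsup (fun D =>
        ((CInt aE bE f τ0 n D + n * TInt aE bE f τ0 D : ℝ≥0∞) : EReal)
          + QInt bE f τ0 D ε.1)
      (𝓝[>] (mGlob aE bE f))

/-- `l_i^n(τ0) = lim_{ε↘0} liminf_{D↘m} (C'_n(D) + n·T(D) − Q'(D,ε))`. -/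
def lI (aE bE : EReal) (f : ℝ → ℝ) (τ0 : ℝ) (n : ℕ) : EReal :=
  ⨆ ε : {e : ℝ // 0 < e},
    liminf (fun D =>
        ((CInt' aE bE f τ0 n D + n * TInt aE bE f τ0 D : ℝ≥0∞) : EReal)
          - QInt' aE f τ0 D ε.1)
      (𝓝[>] (mGlob aE bE f))

/-- `l_s^n(τ0) = lim_{ε↘0} limsup_{D↘m} (C'_n(D) + n·T(D) + Q'(D,ε))`. -/
def lS (aE bE : EReal) (f : ℝ → ℝ) (τ0 : ℝ) (n : ℕ) : EReal :=
  ⨅ ε : {e : ℝ // 0 < e},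
    limsup (fun D =>
        ((CInt' aE bE f τ0 n D + n * TInt aE bE f τ0 D : ℝ≥0∞) : EReal)
          + QInt' aE f τ0 D ε.1)
      (𝓝[>] (mGlob aE bE f))

/-- Condition (R). -/
def CondR (aE bE : EReal) (f : ℝ → ℝ) (J : Set ℝ) : Prop :=
  (∀ τ ∈ II aE bE, mGlob aE bE f < G f τ) ∧
  mA aE f = (mGlob aE bE f : EReal) ∧ mB bE f = (mGlob aE bE f : EReal) ∧
  ∀ τ0 ∈ II aE bE,
    (Icc (rI aE bE f τ0 0) ((EMetric.diam J : ℝ≥0∞) : EReal) ⊆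
        ⋃ n : ℕ, Icc (rI aE bE f τ0 n) (rS aE bE f τ0 n)) ∧
    (Icc (lI aE bE f τ0 0) ((EMetric.diam J : ℝ≥0∞) : EReal) ⊆
        ⋃ n : ℕ, Icc (lI aE bE f τ0 n) (lS aE bE f τ0 n))

end GRW

open Set Filter MeasureTheory Topology GRW
open scoped ENNReal

theorem geoAux_flow (w : ℝ → ℝ) (hw : Continuous w) (m : ℝ) (hm : 0 < m) (hmw : ∀ s, m ≤ w s)
    (τ0 : ℝ) : ∃ σ : ℝ → ℝ, σ 0 = τ0 ∧ StrictMono σ ∧ Function.Surjective σ ∧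
      ∀ t, HasDerivAt σ (w (σ t))⁻¹ t := by
  set T : ℝ → ℝ := fun τ => ∫ s in τ0..τ, w s with hT
  have hTd : ∀ τ, HasDerivAt T (w τ) τ := fun τ =>
    intervalIntegral.integral_hasDerivAt_right (hw.intervalIntegrable _ _)
      (hw.stronglyMeasurableAtFilter _ _) hw.continuousAt
  have hTc : Continuous T := continuous_iff_continuousAt.2 fun τ => (hTd τ).continuousAt
  have hmono : StrictMono T := strictMono_of_deriv_pos fun τ => by
    rw [(hTd τ).deriv]; exact hm.trans_le (hmw τ)
  have hd2 : ∀ τ, HasDerivAt (fun τ => T τ - m * τ) (w τ - m) τ := fun τ => by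
    refine ((hTd τ).sub ((hasDerivAt_id τ).const_mul m)).congr_deriv ?_
    ring
  have hmono2 : Monotone (fun τ => T τ - m * τ) :=
    monotone_of_deriv_nonneg (fun τ => (hd2 τ).differentiableAt) fun τ => by
      rw [(hd2 τ).deriv]; linarith [hmw τ]
  have hsurj : Function.Surjective T := by
    apply hTc.surjective
    · apply tendsto_atTop_mono' (f₁ := fun τ => m * τ + (T 0 - m * 0))
      · filter_upwards [eventually_ge_atTop 0] with τ hτ
        have := hmono2 hτ
        simp only at this
        linarith
      · exact tendsto_atTop_add_const_right _ _ (tendsto_id.const_mul_atTop hm)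
    · apply tendsto_atBot_mono' (f₁ := fun τ => m * τ + (T 0 - m * 0))
      · filter_upwards [eventually_le_atBot 0] with τ hτ
        have := hmono2 hτ
        simp only at this
        linarith
      · exact tendsto_atBot_add_const_right _ _ (tendsto_id.const_mul_atBot hm)
  let e := hmono.orderIsoOfSurjective T hsurj
  have he : ∀ τ, e τ = T τ := fun τ => rfl
  have hT0 : T τ0 = 0 := by simp [hT]
  refine ⟨e.symm, ?_, e.symm.strictMono, e.symm.surjective, fun t => ?_⟩
  · rw [e.symm_apply_eq, he, hT0]
  · refine HasDerivAt.of_local_left_inverse (f := T) e.symm.continuous.continuousAt (hTd _)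
      (hm.trans_le (hmw _)).ne' (Eventually.of_forall fun y => ?_)
    rw [← he, e.apply_symm_apply]

theorem geoAux_c2 (σ F : ℝ → ℝ) (t1 : ℝ) (ht1 : 0 < t1)
    (hd : ∀ t ∈ Icc 0 t1, HasDerivWithinAt σ (F t) (Icc 0 t1) t)
    (hF : ContDiffOn ℝ 1 F (Icc 0 t1)) : ContDiffOn ℝ 2 σ (Icc 0 t1) := by
  have hu := uniqueDiffOn_Icc ht1
  have h2 : (2 : WithTop ℕ∞) = 1 + 1 := by norm_num
  rw [h2, contDiffOn_succ_iff_derivWithin hu]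
  refine ⟨fun t ht => (hd t ht).differentiableWithinAt, by simp, ?_⟩
  exact hF.congr fun t ht => (hd t ht).derivWithin (hu t ht)

theorem geoAux_c1 (σ F : ℝ → ℝ) (t1 : ℝ) (ht1 : 0 < t1)
    (hd : ∀ t ∈ Icc 0 t1, HasDerivWithinAt σ (F t) (Icc 0 t1) t)
    (hF : ContinuousOn F (Icc 0 t1)) : ContDiffOn ℝ 1 σ (Icc 0 t1) := by
  have hu := uniqueDiffOn_Icc ht1
  have h2 : (1 : WithTop ℕ∞) = 0 + 1 := by norm_num
  rw [h2, contDiffOn_succ_iff_derivWithin hu]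
  refine ⟨fun t ht => (hd t ht).differentiableWithinAt, by simp, ?_⟩
  exact (contDiffOn_zero.2 hF).congr fun t ht => (hd t ht).derivWithin (hu t ht)

theorem geoAux_isOpen (aE bE : EReal) : IsOpen (II aE bE) := by
  have : II aE bE = (fun τ : ℝ => (τ : EReal)) ⁻¹' (Ioo aE bE) := rfl
  rw [this]
  exact isOpen_Ioo.preimage continuous_coe_real_ereal

/-- If `τ0 < τ0'`, `|x0' - x0| > 0`, `G > D` on `[τ0, τ0']` and
`∫_{τ0}^{τ0'} f⁻²(G−D)^{-1/2} = |x0' - x0|`, then there is a geodesic `γ : [0,t1] → M`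
of `g^f` joining `(τ0,x0)` to `(τ0',x0')` with energy `D`. -/
theorem geodesic_of_integral_eq
    (aE bE : EReal) (hab : aE < bE) (f : ℝ → ℝ)
    (hf : ContDiffOn ℝ (⊤ : ℕ∞) f (II aE bE)) (hfpos : ∀ τ ∈ II aE bE, 0 < f τ)
    (J : Set ℝ) (hJ : ∃ c d : EReal, c < d ∧ J = {x : ℝ | c < (x : EReal) ∧ (x : EReal) < d})
    (τ0 τ0' x0 x0' : ℝ) (hτ0 : τ0 ∈ II aE bE) (hτ0' : τ0' ∈ II aE bE)
    (hx0 : x0 ∈ J) (hx0' : x0' ∈ J) (hlt : τ0 < τ0') (hL : 0 < |x0' - x0|)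
    (D : ℝ) (hGD : ∀ τ ∈ Icc τ0 τ0', D < G f τ)
    (hint : (∫ τ in τ0..τ0', (f τ ^ 2 * Real.sqrt (G f τ - D))⁻¹) = |x0' - x0|) :
    ∃ (t1 : ℝ) (σ x : ℝ → ℝ), 0 < t1 ∧ IsGeodesicOn aE bE f J σ x 0 t1 ∧
      σ 0 = τ0 ∧ x 0 = x0 ∧ σ t1 = τ0' ∧ x t1 = x0' ∧
      ∀ t ∈ Icc 0 t1, energyW f σ x 0 t1 t = D := by
  have hopen := geoAux_isOpen aE bE
  have hsub : Icc τ0 τ0' ⊆ II aE bE := fun s hs =>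
    ⟨hτ0.1.trans_le (EReal.coe_le_coe_iff.2 hs.1),
      (EReal.coe_le_coe_iff.2 hs.2).trans_lt hτ0'.2⟩
  set U : Set ℝ := II aE bE with hU
  -- smoothness of G
  have hf1 : ContDiffOn ℝ 1 f U := hf.of_le (by exact_mod_cast le_top)
  have hGc : ContDiffOn ℝ 1 (G f) U := by
    unfold G
    exact (hf1.pow 2).inv fun s hs => (pow_pos (hfpos s hs) 2).ne'
  have hfd : ∀ s ∈ U, HasDerivAt f (deriv f s) s := fun s hs =>
    ((hf1.differentiableOn (by norm_num) s hs).differentiableAt (hopen.mem_nhds hs)).hasDerivAt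
  have hGd : ∀ s ∈ U, HasDerivAt (G f) (-(2 * deriv f s / f s ^ 3)) s := fun s hs => by
    have hp := hfpos s hs
    have := ((hfd s hs).pow 2).inv (pow_pos hp 2).ne'
    refine this.congr_deriv ?_
    field_simp
    simp
    ring
  set K := Icc τ0 τ0' with hK
  set v : ℝ → ℝ := fun s => Real.sqrt (G f s - D) with hv
  have hvpos : ∀ s ∈ K, 0 < v s := fun s hs => Real.sqrt_pos.2 (sub_pos.2 (hGD s hs))
  have hvsq : ∀ s ∈ K, v s ^ 2 = G f s - D := fun s hs =>
    Real.sq_sqrt (sub_pos.2 (hGD s hs)).le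
  have hvC : ContDiffOn ℝ 1 v K :=
    ((hGc.mono hsub).sub contDiffOn_const).sqrt fun s hs => (sub_pos.2 (hGD s hs)).ne'
  have hvd : ∀ s ∈ K, HasDerivAt v (-(2 * deriv f s / f s ^ 3) / (2 * v s)) s := fun s hs =>
    ((hGd s (hsub hs)).sub_const D).sqrt (sub_pos.2 (hGD s hs)).ne'
  -- extended functions
  have hle := hlt.le
  set w : ℝ → ℝ := IccExtend hle (fun s : K => (v s)⁻¹) with hw
  have hwc : Continuous w := by
    refine Continuous.Icc_extend' ?_
    exact (hvC.continuousOn.inv₀ fun s hs => (hvpos s hs).ne').restrict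
  have hwK : ∀ s ∈ K, w s = (v s)⁻¹ := fun s hs => IccExtend_of_mem hle _ hs
  set p : ℝ → ℝ := IccExtend hle (fun s : K => (f s ^ 2 * v s)⁻¹) with hp
  have hpc : Continuous p := by
    refine Continuous.Icc_extend' ?_
    refine ContinuousOn.restrict (f := fun s => (f s ^ 2 * v s)⁻¹) ?_
    refine ContinuousOn.inv₀ (((hf1.continuousOn.mono hsub).pow 2).mul hvC.continuousOn) ?_
    exact fun s hs => (mul_pos (pow_pos (hfpos s (hsub hs)) 2) (hvpos s hs)).ne'
  have hpK : ∀ s ∈ K, p s = (f s ^ 2 * v s)⁻¹ := fun s hs => IccExtend_of_mem hle _ hs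
  have hppos : ∀ s ∈ K, 0 ≤ p s := fun s hs => by
    rw [hpK s hs]
    exact (inv_pos.2 (mul_pos (pow_pos (hfpos s (hsub hs)) 2) (hvpos s hs))).le
  obtain ⟨m, hm, hmw⟩ : ∃ m, 0 < m ∧ ∀ s, m ≤ w s := by
    obtain ⟨s0, hs0, hmin⟩ := isCompact_Icc.exists_isMinOn (nonempty_Icc.2 hle)
      (hwc.continuousOn (s := K))
    refine ⟨w s0, by rw [hwK s0 hs0]; exact inv_pos.2 (hvpos s0 hs0), fun s => ?_⟩
    have h1 : w s = w (projIcc τ0 τ0' hle s) := by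
      simp [hw, IccExtend]
    rw [h1]
    exact hmin (projIcc τ0 τ0' hle s).2
  obtain ⟨σ, hσ0, hσm, hσs, hσd⟩ := geoAux_flow w hwc m hm hmw τ0
  obtain ⟨t1, ht1e⟩ := hσs τ0'
  have ht1 : 0 < t1 := by
    rw [← hσm.lt_iff_lt, hσ0, ht1e]; exact hlt
  have hmap : ∀ t ∈ Icc 0 t1, σ t ∈ K := fun t ht =>
    ⟨hσ0 ▸ hσm.monotone ht.1, ht1e ▸ hσm.monotone ht.2⟩
  have hσd' : ∀ t ∈ Icc 0 t1, HasDerivAt σ (v (σ t)) t := fun t ht => by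
    have := hσd t
    rwa [hwK _ (hmap t ht), inv_inv] at this
  obtain ⟨ε, hε, hεL⟩ : ∃ ε : ℝ, ε ^ 2 = 1 ∧ ε * |x0' - x0| = x0' - x0 := by
    rcases le_total 0 (x0' - x0) with h | h
    · exact ⟨1, by norm_num, by rw [abs_of_nonneg h]; ring⟩
    · exact ⟨-1, by norm_num, by rw [abs_of_nonpos h]; ring⟩
  set P : ℝ → ℝ := fun τ => ∫ s in τ0..τ, p s with hP
  have hPd : ∀ τ, HasDerivAt P (p τ) τ := fun τ =>
    intervalIntegral.integral_hasDerivAt_right (hpc.intervalIntegrable _ _)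
      (hpc.stronglyMeasurableAtFilter _ _) hpc.continuousAt
  have hP0 : P τ0 = 0 := by simp [hP]
  have hP1 : P τ0' = |x0' - x0| := by
    rw [← hint]
    refine intervalIntegral.integral_congr fun s hs => ?_
    rw [uIcc_of_le hle] at hs
    exact hpK s hs
  have hPmono : MonotoneOn P K := by
    refine monotoneOn_of_deriv_nonneg (convex_Icc _ _)
      (fun s _ => (hPd s).continuousAt.continuousWithinAt)
      (fun s _ => (hPd s).differentiableAt.differentiableWithinAt) fun s hs => ?_
    rw [(hPd s).deriv]
    exact hppos s (interior_subset hs)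
  set x : ℝ → ℝ := fun t => x0 + ε * P (σ t) with hx
  have hxd : ∀ t ∈ Icc 0 t1, HasDerivAt x (ε * G f (σ t)) t := fun t ht => by
    have h1 := (((hPd (σ t)).comp t (hσd' t ht)).const_mul ε).const_add x0
    refine h1.congr_deriv ?_
    rw [hpK _ (hmap t ht), G]
    have h2 := hvpos _ (hmap t ht)
    have h3 := hfpos _ (hsub (hmap t ht))
    field_simp
  have hu := uniqueDiffOn_Icc ht1
  have e1 : ∀ t ∈ Icc 0 t1, derivWithin σ (Icc 0 t1) t = v (σ t) := fun t ht =>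
    (hσd' t ht).hasDerivWithinAt.derivWithin (hu t ht)
  have e2 : ∀ t ∈ Icc 0 t1, derivWithin x (Icc 0 t1) t = ε * G f (σ t) := fun t ht =>
    (hxd t ht).hasDerivWithinAt.derivWithin (hu t ht)
  have hσc : ContinuousOn σ (Icc 0 t1) := fun t ht =>
    (hσd' t ht).continuousAt.continuousWithinAt
  have hσ1 : ContDiffOn ℝ 1 σ (Icc 0 t1) :=
    geoAux_c1 σ (fun t => v (σ t)) t1 ht1 (fun t ht => (hσd' t ht).hasDerivWithinAt)
      (hvC.continuousOn.comp hσc hmap)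
  refine ⟨t1, σ, x, ht1, ⟨fun t ht => hsub (hmap t ht), fun t ht => ?_, ?_, ?_, ?_, ?_⟩,
    hσ0, ?_, ht1e, ?_, ?_⟩
  · have hord : J.OrdConnected := by
      obtain ⟨c, d, _, rfl⟩ := hJ
      refine ⟨fun y hy z hz r hr => ?_⟩
      exact ⟨hy.1.trans_le (EReal.coe_le_coe_iff.2 hr.1),
        (EReal.coe_le_coe_iff.2 hr.2).trans_lt hz.2⟩
    have hk := hmap t ht
    have l0 : 0 ≤ P (σ t) := hP0 ▸ hPmono (left_mem_Icc.2 hle) hk hk.1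
    have l1 : P (σ t) ≤ |x0' - x0| := hP1 ▸ hPmono hk (right_mem_Icc.2 hle) hk.2
    refine hord.uIcc_subset hx0 hx0' ?_
    have hε' : ε = 1 ∨ ε = -1 := by
      have h0 : (ε - 1) * (ε + 1) = 0 := by linarith [hε, show (ε - 1) * (ε + 1) = ε ^ 2 - 1 by ring]
      rcases mul_eq_zero.1 h0 with h | h
      · left; linarith
      · right; linarith
    rw [mem_uIcc]
    rcases hε' with rfl | rfl
    · left; simp only [hx]; constructor <;> linarith
    · right; simp only [hx]; constructor <;> linarith
  · exact geoAux_c2 σ (fun t => v (σ t)) t1 ht1 (fun t ht => (hσd' t ht).hasDerivWithinAt)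
      (hvC.comp hσ1 hmap)
  · exact geoAux_c2 x (fun t => ε * G f (σ t)) t1 ht1 (fun t ht => (hxd t ht).hasDerivWithinAt)
      (contDiffOn_const.mul ((hGc.mono hsub).comp hσ1 hmap))
  · intro t ht
    have hk := hmap t ht
    rw [derivWithin_congr e1 (e1 t ht), e2 t ht,
      show derivWithin (fun r => v (σ r)) (Icc 0 t1) t = _ from
        (((hvd _ hk).comp t (hσd' t ht)).hasDerivWithinAt).derivWithin (hu t ht), G]
    have h2 := hvpos _ hk
    have h3 := hfpos _ (hsub hk)
    rw [mul_pow, hε]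
    field_simp
  · intro t ht
    have hk := hmap t ht
    rw [derivWithin_congr e2 (e2 t ht), e1 t ht, e2 t ht,
      show derivWithin (fun r => ε * G f (σ r)) (Icc 0 t1) t = _ from
        ((((hGd _ (hsub hk)).comp t (hσd' t ht)).const_mul ε).hasDerivWithinAt).derivWithin
        (hu t ht), G]
    have h3 := hfpos _ (hsub hk)
    field_simp
  · simp [hx, hσ0, hP0]
  · simp only [hx, ht1e, hP1, hεL]; ring
  · intro t ht
    have hk := hmap t ht
    have h3 := hfpos _ (hsub hk)
    rw [energyW, e1 t ht, e2 t ht, hvsq _ hk, mul_pow, hε, G]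
    field_simp
    ring
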